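/- arXiv:1407.5559 — 3 statements merged into one kernel-verified Lean document; each statement's English description precedes it below -/
import Mathlib

section
/- Let n ≥ 1, 0 < α < 2, and let Ω ⊂ ℝⁿ be a bounded open set. Suppose v ∈ L_α is lower semicontinuous on the closure of Ω, that for every x ∈ Ω the principal value lim_{ε→0⁺} ∫_{{z : |x-z| > ε}} (v(x) - v(z))/|x-z|^{n+α} dz exists and is ≥ 0, and that v(x) ≥ 0 for every x ∈ ℝⁿ \ Ω. Then v(x) ≥ 0 for every x ∈ Ω. -/
open MeasureTheory Filter Topology Metric

noncomputable section

/-- Membership in the space `L_α`. -/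
def InLalpha (n : ℕ) (α : ℝ) (u : EuclideanSpace ℝ (Fin n) → ℝ) : Prop :=
  Integrable (fun x : EuclideanSpace ℝ (Fin n) => u x / (1 + ‖x‖ ^ ((n : ℝ) + α)))

/-- Away from the diagonal, the kernel `‖x - z‖ ^ (-p)` is controlled by `(1 + ‖z‖) ^ (-p)`. -/
theorem one_add_norm_rpow_le {E : Type*} [SeminormedAddCommGroup E] {p ε : ℝ} (hp : 0 ≤ p)
    (hε : 0 < ε) {x z : E} (hz : ε < ‖x - z‖) :
    (1 + ‖z‖) ^ p ≤ ((1 + ‖x‖) / ε + 1) ^ p * ‖x - z‖ ^ p := by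
  rw [← Real.mul_rpow (by positivity) (norm_nonneg _)]
  refine Real.rpow_le_rpow (by positivity) ?_ hp
  have h1 : ‖z‖ ≤ ‖x‖ + ‖x - z‖ := norm_le_norm_add_norm_sub x z
  have h2 : 1 + ‖x‖ ≤ (1 + ‖x‖) / ε * ‖x - z‖ := by
    rw [div_mul_eq_mul_div, le_div_iff₀ hε]
    exact mul_le_mul_of_nonneg_left hz.le (by positivity)
  linarith

theorem measurableSet_lt_norm_sub {E : Type*} [SeminormedAddCommGroup E] [MeasurableSpace E]
    [BorelSpace E] (x : E) (ε : ℝ) : MeasurableSet {z : E | ε < ‖x - z‖} :=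
  (isOpen_lt continuous_const (by fun_prop)).measurableSet

/-- The truncated fractional kernel is integrable. -/
theorem integrableOn_const_div_norm_sub_rpow {n : ℕ} {p ε : ℝ} (hp : (n : ℝ) < p)
    (hε : 0 < ε) (x : EuclideanSpace ℝ (Fin n)) (c : ℝ) :
    IntegrableOn (fun z => c / ‖x - z‖ ^ p) {z | ε < ‖x - z‖} := by
  have hp0 : 0 < p := lt_of_le_of_lt n.cast_nonneg hp
  have h1 : Integrable (fun z : EuclideanSpace ℝ (Fin n) => (1 + ‖z‖) ^ (-p)) :=
    integrable_one_add_norm (by simpa using hp)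
  refine ((h1.const_mul (|c| * ((1 + ‖x‖) / ε + 1) ^ p)).integrableOn).mono'
    (Measurable.aestronglyMeasurable (by fun_prop)) ?_
  refine (ae_restrict_iff' (measurableSet_lt_norm_sub x ε)).2 (Eventually.of_forall fun z hz => ?_)
  have hz' : ε < ‖x - z‖ := hz
  have hpos : 0 < ‖x - z‖ ^ p := Real.rpow_pos_of_pos (hε.trans hz') p
  have hz1 : 0 < (1 + ‖z‖) ^ p := Real.rpow_pos_of_pos (by positivity) p
  rw [norm_div, Real.norm_eq_abs, Real.norm_of_nonneg hpos.le, Real.rpow_neg (by positivity),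
    ← div_eq_mul_inv, div_le_div_iff₀ hpos hz1, mul_assoc]
  exact mul_le_mul_of_nonneg_left (one_add_norm_rpow_le hp0.le hε hz') (abs_nonneg c)

/-- A function in `L_α` is integrable against the truncated fractional kernel. -/
theorem InLalpha.integrableOn_div_norm_sub_rpow {n : ℕ} {α ε : ℝ} (hα : 0 < α) (hε : 0 < ε)
    {v : EuclideanSpace ℝ (Fin n) → ℝ} (hv : InLalpha n α v) (x : EuclideanSpace ℝ (Fin n)) :
    IntegrableOn (fun z => v z / ‖x - z‖ ^ ((n : ℝ) + α)) {z | ε < ‖x - z‖} := by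
  have hp0 : 0 < (n : ℝ) + α := by positivity
  set p := (n : ℝ) + α with hp
  have hv' : IntegrableOn (fun z => v z / (1 + ‖z‖ ^ p)) {z | ε < ‖x - z‖} :=
    Integrable.integrableOn hv
  have key : IntegrableOn (fun z => (1 + ‖z‖ ^ p) / ‖x - z‖ ^ p * (v z / (1 + ‖z‖ ^ p)))
      {z | ε < ‖x - z‖} := by
    refine hv'.bdd_mul (c := 2 * ((1 + ‖x‖) / ε + 1) ^ p)
      (Measurable.aestronglyMeasurable (by fun_prop)) ?_
    refine (ae_restrict_iff' (measurableSet_lt_norm_sub x ε)).2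
      (Eventually.of_forall fun z hz => ?_)
    have hz' : ε < ‖x - z‖ := hz
    have hpos : 0 < ‖x - z‖ ^ p := Real.rpow_pos_of_pos (hε.trans hz') p
    have h1 : 1 ≤ (1 + ‖z‖) ^ p := Real.one_le_rpow (by simp) hp0.le
    have h2 : ‖z‖ ^ p ≤ (1 + ‖z‖) ^ p :=
      Real.rpow_le_rpow (norm_nonneg _) (by simp) hp0.le
    rw [Real.norm_of_nonneg (by positivity), div_le_iff₀ hpos]
    linarith [one_add_norm_rpow_le hp0.le hε hz']
  refine key.congr_fun (fun z _ => ?_) (measurableSet_lt_norm_sub x ε)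
  have : (1 + ‖z‖ ^ p) ≠ 0 := by positivity
  simp only
  field_simp

/-- Silvestre's maximum principle: if `v ∈ L_α` is lower semicontinuous on `closure Ω`,
satisfies `(-Δ)^{α/2} v ≥ 0` pointwise in the bounded open set `Ω` (the principal value
exists and is nonnegative), and `v ≥ 0` outside `Ω`, then `v ≥ 0` in `Ω`. -/
theorem fractional_maximum_principle (n : ℕ) (hn : 1 ≤ n) (α : ℝ)
    (hα0 : 0 < α) (hα2 : α < 2)
    (Ω : Set (EuclideanSpace ℝ (Fin n))) (hΩo : IsOpen Ω) (hΩb : Bornology.IsBounded Ω)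
    (v : EuclideanSpace ℝ (Fin n) → ℝ)
    (hv_L : InLalpha n α v)
    (hv_lsc : LowerSemicontinuousOn v (closure Ω))
    (hv_super : ∀ x ∈ Ω, ∃ L : ℝ, 0 ≤ L ∧
      Tendsto (fun ε : ℝ =>
          ∫ z in {z : EuclideanSpace ℝ (Fin n) | ε < ‖x - z‖},
            (v x - v z) / ‖x - z‖ ^ ((n : ℝ) + α))
        (𝓝[>] 0) (𝓝 L))
    (hv_out : ∀ x ∉ Ω, 0 ≤ v x) :
    ∀ x ∈ Ω, 0 ≤ v x := by
  by_contra! hneg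
  obtain ⟨x₁, hx₁, hvx₁⟩ := hneg
  obtain ⟨x, hxc, hmin⟩ := hv_lsc.exists_isMinOn ⟨x₁, subset_closure hx₁⟩ hΩb.isCompact_closure
  have hvx : v x < 0 := lt_of_le_of_lt (hmin (subset_closure hx₁)) hvx₁
  have hx : x ∈ Ω := by
    by_contra h
    exact absurd (hv_out x h) (not_le.2 hvx)
  have hmin' : ∀ z, v x ≤ v z := fun z => by
    by_cases hz : z ∈ Ω
    · exact hmin (subset_closure hz)
    · exact hvx.le.trans (hv_out z hz)
  obtain ⟨L, hL0, hL⟩ := hv_super x hx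
  obtain ⟨R, hR, hΩR⟩ := hΩb.subset_closedBall_lt 0 x
  set f : EuclideanSpace ℝ (Fin n) → ℝ := fun z => (v z - v x) / ‖x - z‖ ^ ((n : ℝ) + α) with hf
  have hf0 : ∀ z, 0 ≤ f z := fun z =>
    div_nonneg (sub_nonneg.2 (hmin' z)) (Real.rpow_nonneg (norm_nonneg _) _)
  have hfi : ∀ ε > 0, IntegrableOn f {z | ε < ‖x - z‖} := fun ε hε => by
    simp only [hf, sub_div]
    exact (hv_L.integrableOn_div_norm_sub_rpow hα0 hε x).sub
      (integrableOn_const_div_norm_sub_rpow (by linarith) hε x _)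
  have hpos : 0 < ∫ z in {z | R < ‖x - z‖}, f z := by
    rw [setIntegral_pos_iff_support_of_nonneg_ae (Eventually.of_forall hf0) (hfi R hR)]
    have hsub : {z | R < ‖x - z‖} ⊆ Function.support f ∩ {z | R < ‖x - z‖} := fun z hz => by
      refine ⟨(div_pos ?_ (Real.rpow_pos_of_pos (hR.trans hz) _)).ne', hz⟩
      have hzΩ : z ∉ Ω := fun h => by
        have := mem_closedBall'.1 (hΩR h)
        rw [dist_eq_norm] at this
        exact absurd hz (not_lt.2 this)
      linarith [hv_out z hzΩ]
    refine lt_of_lt_of_le ?_ (measure_mono hsub)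
    refine IsOpen.measure_pos _ (isOpen_lt continuous_const (by fun_prop)) ?_
    have : Nonempty (Fin n) := ⟨⟨0, hn⟩⟩
    obtain ⟨w, hw⟩ := NormedSpace.exists_lt_norm ℝ (EuclideanSpace ℝ (Fin n)) R
    exact ⟨x - w, by simpa using hw⟩
  have hle : L ≤ -∫ z in {z | R < ‖x - z‖}, f z := by
    refine le_of_tendsto hL ?_
    filter_upwards [Ioo_mem_nhdsGT hR] with ε hε
    have hfneg : ∀ z, (v x - v z) / ‖x - z‖ ^ ((n : ℝ) + α) = -f z := fun z => by
      rw [hf, ← neg_div, neg_sub]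
    simp only [hfneg, integral_neg]
    refine neg_le_neg (setIntegral_mono_set (hfi ε hε.1) (Eventually.of_forall hf0) ?_)
    exact Eventually.of_forall fun z hz => hε.2.trans hz
  linarith
end
end

section
/- Let n ≥ 1, 0 < α < 2, and let u ∈ L_α be differentiable with Lipschitz continuous gradient on some open ball around a point x ∈ ℝⁿ. Then lim_{r→0⁺} r^{-α} [u(x) - (ε_α^{(r)} * u)(x)] = c lim_{r→0⁺} ∫_{{y : |y-x| > r}} (u(x) - u(y))/|x-y|^{n+α} dy, where c = (Γ(n/2)/π^{n/2+1}) sin(πα/2); in particular both limits exist. -/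
open MeasureTheory Filter Topology Metric

noncomputable section

/-- The averaging kernel `ε_α^{(r)}`. -/
def avgKernel (n : ℕ) (α r : ℝ) (x : EuclideanSpace ℝ (Fin n)) : ℝ :=
  if r < ‖x‖ then
    (Real.Gamma ((n : ℝ) / 2) / Real.pi ^ ((n : ℝ) / 2 + 1)) * Real.sin (Real.pi * α / 2) *
      (r ^ α / ((‖x‖ ^ 2 - r ^ 2) ^ (α / 2) * ‖x‖ ^ n))
  else 0

/-- The convolution `(ε_α^{(r)} * w)(x) = ∫_{|y-x|>r} ε_α^{(r)}(x-y) w(y) dy`. -/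
def avgConv (n : ℕ) (α r : ℝ) (w : EuclideanSpace ℝ (Fin n) → ℝ)
    (x : EuclideanSpace ℝ (Fin n)) : ℝ :=
  ∫ y in {y : EuclideanSpace ℝ (Fin n) | r < ‖y - x‖}, avgKernel n α r (x - y) * w y

theorem sq_rpow_half {α t : ℝ} (ht : 0 ≤ t) : (t ^ 2) ^ (α / 2) = t ^ α := by
  rw [← Real.rpow_natCast, ← Real.rpow_mul ht]
  congr 1
  push_cast
  ring

theorem integrable_beta {a : ℝ} (h0 : 0 < a) (h1 : a < 1) :
    IntegrableOn (fun w : ℝ => w ^ (a - 1) * (1 - w) ^ (-a)) (Set.Ioo 0 1) ∧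
    ∫ w in Set.Ioo (0 : ℝ) 1, w ^ (a - 1) * (1 - w) ^ (-a) =
      Real.pi / Real.sin (Real.pi * a) := by
  have hre : ∀ w ∈ Set.Ioo (0 : ℝ) 1,
      ((w : ℂ) ^ ((a : ℂ) - 1) * (1 - (w : ℂ)) ^ (((1 - a : ℝ) : ℂ) - 1)) =
        ((w ^ (a - 1) * (1 - w) ^ (-a) : ℝ) : ℂ) := by
    intro w hw
    have h2 : (0 : ℝ) ≤ 1 - w := by linarith [hw.2]
    rw [Complex.ofReal_mul, Complex.ofReal_cpow hw.1.le, Complex.ofReal_cpow h2]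
    push_cast
    congr 2
    ring
  have hconv := Complex.betaIntegral_convergent (u := (a : ℂ)) (v := ((1 - a : ℝ) : ℂ))
    (by simpa using h0) (by simpa using h1)
  rw [intervalIntegrable_iff_integrableOn_Ioo_of_le zero_le_one,
    integrableOn_congr_fun hre measurableSet_Ioo] at hconv
  refine ⟨by simpa [IntegrableOn] using hconv.re, ?_⟩
  have hB := Complex.betaIntegral_eq_Gamma_mul_div (a : ℂ) ((1 - a : ℝ) : ℂ)
    (by simpa using h0) (by simpa using h1)
  rw [Complex.betaIntegral, intervalIntegral.integral_of_le zero_le_one,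
    integral_Ioc_eq_integral_Ioo, setIntegral_congr_fun measurableSet_Ioo hre,
    integral_complex_ofReal, ← Complex.ofReal_add, Complex.Gamma_ofReal, Complex.Gamma_ofReal,
    Complex.Gamma_ofReal] at hB
  have hB' := by exact_mod_cast hB
  rw [hB', Real.Gamma_mul_Gamma_one_sub]
  simp

theorem image_rpow_neg_half {r : ℝ} (hr : 0 < r) :
    (fun w : ℝ => r * w ^ (-(1 / 2) : ℝ)) '' Set.Ioo 0 1 = Set.Ioi r := by
  ext y
  simp only [Set.mem_image, Set.mem_Ioo, Set.mem_Ioi]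
  constructor
  · rintro ⟨w, ⟨hw0, hw1⟩, rfl⟩
    have := Real.one_lt_rpow_of_pos_of_lt_one_of_neg hw0 hw1 (z := (-(1 / 2) : ℝ)) (by norm_num)
    nlinarith
  · intro hy
    have hy0 : 0 < y := hr.trans hy
    have h1 : r / y < 1 := (div_lt_one hy0).2 hy
    have h0 : 0 < r / y := by positivity
    refine ⟨(r / y) ^ (2 : ℝ), ⟨by positivity, Real.rpow_lt_one h0.le h1 (by norm_num)⟩, ?_⟩
    rw [← Real.rpow_mul h0.le]
    norm_num
    rw [Real.rpow_neg_one]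
    field_simp

theorem injOn_rpow_neg_half {r : ℝ} (hr : 0 < r) :
    Set.InjOn (fun w : ℝ => r * w ^ (-(1 / 2) : ℝ)) (Set.Ioo 0 1) := by
  intro a ha b hb hab
  have h := mul_left_cancel₀ hr.ne' hab
  exact (Real.rpow_left_inj ha.1.le hb.1.le (by norm_num)).1 h

theorem radial_jacobian {α r w : ℝ} (hr : 0 < r) (hw : w ∈ Set.Ioo (0 : ℝ) 1) :
    |r * (-(1 / 2) * w ^ (-(1 / 2) - 1 : ℝ))| •
      (r ^ α / (((r * w ^ (-(1 / 2) : ℝ)) ^ 2 - r ^ 2) ^ (α / 2) * (r * w ^ (-(1 / 2) : ℝ)))) =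
    1 / 2 * (w ^ (α / 2 - 1) * (1 - w) ^ (-(α / 2))) := by
  obtain ⟨hw0, hw1⟩ := hw
  have h1w : 0 < 1 - w := by linarith
  have hsq : (r * w ^ (-(1 / 2) : ℝ)) ^ 2 - r ^ 2 = r ^ 2 * ((1 - w) * w⁻¹) := by
    rw [mul_pow, ← Real.rpow_natCast (w ^ _), ← Real.rpow_mul hw0.le]
    norm_num
    rw [Real.rpow_neg_one]
    field_simp
  have habs : |r * (-(1 / 2) * w ^ (-(1 / 2) - 1 : ℝ))| =
      r * (1 / 2 * (w ^ (-(1 / 2) : ℝ) * w⁻¹)) := by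
    rw [Real.rpow_sub_one hw0.ne', abs_mul, abs_mul, abs_of_pos hr,
      abs_of_pos (a := w ^ (-(1 / 2) : ℝ) / w) (by positivity)]
    rw [abs_of_neg (by norm_num : (-(1 / 2) : ℝ) < 0)]
    ring
  rw [hsq, habs, Real.mul_rpow (by positivity) (by positivity),
    Real.mul_rpow h1w.le (by positivity), sq_rpow_half hr.le, Real.inv_rpow hw0.le, Real.rpow_neg h1w.le,
    Real.rpow_sub_one hw0.ne', smul_eq_mul]
  have e1 : 0 < w ^ (-(1 / 2) : ℝ) := by positivity
  have e2 : 0 < w ^ (α / 2) := by positivity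
  have e3 : 0 < (1 - w) ^ (α / 2) := by positivity
  have e4 : 0 < r ^ α := by positivity
  field_simp

theorem radial_integral {α r : ℝ} (hα0 : 0 < α) (hα2 : α < 2) (hr : 0 < r) :
    IntegrableOn (fun y : ℝ => r ^ α / ((y ^ 2 - r ^ 2) ^ (α / 2) * y)) (Set.Ioi r) ∧
    ∫ y in Set.Ioi r, r ^ α / ((y ^ 2 - r ^ 2) ^ (α / 2) * y) =
      1 / 2 * (Real.pi / Real.sin (Real.pi * α / 2)) := by
  have hd : ∀ w ∈ Set.Ioo (0 : ℝ) 1, HasDerivWithinAt (fun w : ℝ => r * w ^ (-(1 / 2) : ℝ))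
      (r * (-(1 / 2) * w ^ (-(1 / 2) - 1 : ℝ))) (Set.Ioo 0 1) w := fun w hw =>
    ((Real.hasDerivAt_rpow_const (Or.inl hw.1.ne')).const_mul r).hasDerivWithinAt
  obtain ⟨hi, hv⟩ := integrable_beta (a := α / 2) (by linarith) (by linarith)
  have hj : ∀ w ∈ Set.Ioo (0 : ℝ) 1, _ := fun w hw => radial_jacobian (α := α) hr hw
  rw [← image_rpow_neg_half hr]
  constructor
  · rw [integrableOn_image_iff_integrableOn_abs_deriv_smul measurableSet_Ioo hd
      (injOn_rpow_neg_half hr), integrableOn_congr_fun hj measurableSet_Ioo]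
    exact hi.const_mul _
  · rw [integral_image_eq_integral_abs_deriv_smul measurableSet_Ioo hd
      (injOn_rpow_neg_half hr), setIntegral_congr_fun measurableSet_Ioo hj,
      integral_const_mul, hv, mul_div_assoc]

/-- The normalizing constant of the averaging kernel. -/
def kernelConst (n : ℕ) (α : ℝ) : ℝ :=
  (Real.Gamma ((n : ℝ) / 2) / Real.pi ^ ((n : ℝ) / 2 + 1)) * Real.sin (Real.pi * α / 2)

theorem sin_half_pos {α : ℝ} (hα0 : 0 < α) (hα2 : α < 2) : 0 < Real.sin (Real.pi * α / 2) := by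
  have := Real.pi_pos
  apply Real.sin_pos_of_pos_of_lt_pi
  · positivity
  · nlinarith

theorem kernelConst_pos {n : ℕ} (hn : 1 ≤ n) {α : ℝ} (hα0 : 0 < α) (hα2 : α < 2) :
    0 < kernelConst n α := by
  have : (0 : ℝ) < n := by exact_mod_cast hn
  have h1 : 0 < Real.Gamma ((n : ℝ) / 2) := Real.Gamma_pos_of_pos (by positivity)
  have h2 := sin_half_pos hα0 hα2
  have := Real.pi_pos
  unfold kernelConst
  positivity

theorem kernelConst_mul_sphere {n : ℕ} (hn : 1 ≤ n) {α : ℝ} (hα0 : 0 < α) (hα2 : α < 2) :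
    (n : ℝ) * (volume.real (ball (0 : EuclideanSpace ℝ (Fin n)) 1) *
      (kernelConst n α * (1 / 2 * (Real.pi / Real.sin (Real.pi * α / 2))))) = 1 := by
  have : Nonempty (Fin n) := ⟨⟨0, hn⟩⟩
  have hn0 : (0 : ℝ) < n := by exact_mod_cast hn
  have h1 : 0 < Real.Gamma ((n : ℝ) / 2) := Real.Gamma_pos_of_pos (by positivity)
  have h2 := sin_half_pos hα0 hα2
  have h3 : √Real.pi ^ n = Real.pi ^ ((n : ℝ) / 2) := by
    rw [Real.sqrt_eq_rpow, ← Real.rpow_natCast, ← Real.rpow_mul Real.pi_pos.le]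
    congr 1
    ring
  have h4 : 0 < Real.pi ^ ((n : ℝ) / 2) := Real.rpow_pos_of_pos Real.pi_pos _
  have hpi := Real.pi_pos
  rw [measureReal_def, EuclideanSpace.volume_ball, Fintype.card_fin, ENNReal.ofReal_one, one_pow,
    one_mul, Real.Gamma_add_one (by positivity), ENNReal.toReal_ofReal (by positivity), h3,
    kernelConst, Real.rpow_add hpi, Real.rpow_one]
  field_simp

theorem avgKernel_radial {n : ℕ} (hn : 1 ≤ n) {α r : ℝ} (hr : 0 < r) (y : ℝ)
    (hy : y ∈ Set.Ioi (0 : ℝ)) :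
    y ^ (n - 1) • (if r < y then kernelConst n α *
        (r ^ α / ((y ^ 2 - r ^ 2) ^ (α / 2) * y ^ n)) else 0) =
      (Set.Ioi r).indicator
        (fun y => kernelConst n α * (r ^ α / ((y ^ 2 - r ^ 2) ^ (α / 2) * y))) y := by
  have hy0 : (0 : ℝ) < y := hy
  by_cases h : r < y
  · have hp : 0 < (y ^ 2 - r ^ 2) ^ (α / 2) := Real.rpow_pos_of_pos (by nlinarith) _
    obtain ⟨m, rfl⟩ : ∃ m, n = m + 1 := ⟨n - 1, by omega⟩
    rw [if_pos h, Set.indicator_of_mem (by exact h), smul_eq_mul, Nat.add_sub_cancel, pow_succ]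
    field_simp
    ring
  · rw [if_neg h, Set.indicator_of_notMem (by exact h), smul_zero]

theorem integrable_avgKernel {n : ℕ} (hn : 1 ≤ n) {α r : ℝ} (hα0 : 0 < α) (hα2 : α < 2)
    (hr : 0 < r) : Integrable (avgKernel n α r) ∧ ∫ z, avgKernel n α r z = 1 := by
  have : Nonempty (Fin n) := ⟨⟨0, hn⟩⟩
  obtain ⟨hi, hv⟩ := radial_integral hα0 hα2 hr
  set f : ℝ → ℝ := fun y => if r < y then kernelConst n α *
    (r ^ α / ((y ^ 2 - r ^ 2) ^ (α / 2) * y ^ n)) else 0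
  have hrw : avgKernel n α r = fun z : EuclideanSpace ℝ (Fin n) => f ‖z‖ := rfl
  have hsub : Set.Ioi (0 : ℝ) ∩ Set.Ioi r = Set.Ioi r :=
    Set.inter_eq_right.2 (Set.Ioi_subset_Ioi hr.le)
  rw [hrw, integrable_fun_norm_addHaar, integral_fun_norm_addHaar, finrank_euclideanSpace_fin,
    integrableOn_congr_fun (avgKernel_radial hn hr) measurableSet_Ioi,
    setIntegral_congr_fun measurableSet_Ioi (avgKernel_radial hn hr)]
  constructor
  · exact ((integrable_indicator_iff measurableSet_Ioi).2 (hi.const_mul _)).integrableOn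
  · rw [setIntegral_indicator measurableSet_Ioi, hsub, integral_const_mul, hv,
      nsmul_eq_mul, smul_eq_mul, kernelConst_mul_sphere hn hα0 hα2]

theorem rpow_add_eq_mul {n : ℕ} {α t : ℝ} (ht : 0 < t) :
    t ^ ((n : ℝ) + α) = t ^ α * t ^ n := by
  rw [Real.rpow_add ht, Real.rpow_natCast, mul_comm]

theorem avgKernel_of_lt {n : ℕ} {α r : ℝ} {z : EuclideanSpace ℝ (Fin n)} (hz : r < ‖z‖) :
    avgKernel n α r z =
      kernelConst n α * (r ^ α / ((‖z‖ ^ 2 - r ^ 2) ^ (α / 2) * ‖z‖ ^ n)) :=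
  if_pos hz

theorem avgKernel_of_le {n : ℕ} {α r : ℝ} {z : EuclideanSpace ℝ (Fin n)} (hz : ‖z‖ ≤ r) :
    avgKernel n α r z = 0 :=
  if_neg hz.not_gt

theorem avgKernel_neg {n : ℕ} {α r : ℝ} (z : EuclideanSpace ℝ (Fin n)) :
    avgKernel n α r (-z) = avgKernel n α r z := by
  simp [avgKernel]

theorem avgKernel_nonneg {n : ℕ} (hn : 1 ≤ n) {α r : ℝ} (hα0 : 0 < α) (hα2 : α < 2)
    (hr : 0 < r) (z : EuclideanSpace ℝ (Fin n)) : 0 ≤ avgKernel n α r z := by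
  have hc := kernelConst_pos hn hα0 hα2
  rcases lt_or_ge r ‖z‖ with h | h
  · rw [avgKernel_of_lt h]
    have : 0 < ‖z‖ ^ 2 - r ^ 2 := by nlinarith
    positivity
  · rw [avgKernel_of_le h]

theorem le_avgKernel {n : ℕ} (hn : 1 ≤ n) {α r : ℝ} (hα0 : 0 < α) (hα2 : α < 2)
    (hr : 0 < r) {z : EuclideanSpace ℝ (Fin n)} (hz : r < ‖z‖) :
    kernelConst n α * (r ^ α / ‖z‖ ^ ((n : ℝ) + α)) ≤ avgKernel n α r z := by
  have hc := kernelConst_pos hn hα0 hα2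
  have hz0 : 0 < ‖z‖ := hr.trans hz
  have h1 : 0 < ‖z‖ ^ 2 - r ^ 2 := by nlinarith
  have h2 : (‖z‖ ^ 2 - r ^ 2) ^ (α / 2) ≤ ‖z‖ ^ α := by
    rw [← sq_rpow_half hz0.le]
    exact Real.rpow_le_rpow h1.le (by nlinarith) (by positivity)
  rw [avgKernel_of_lt hz, rpow_add_eq_mul hz0]
  gcongr

theorem avgKernel_le {n : ℕ} (hn : 1 ≤ n) {α r : ℝ} (hα0 : 0 < α) (hα2 : α < 2)
    (hr : 0 < r) {z : EuclideanSpace ℝ (Fin n)} (hz : 2 * r < ‖z‖) :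
    avgKernel n α r z ≤ 4 * kernelConst n α * (r ^ α / ‖z‖ ^ ((n : ℝ) + α)) := by
  have hc := kernelConst_pos hn hα0 hα2
  have hz0 : 0 < ‖z‖ := by linarith
  have h1 : 0 < ‖z‖ ^ 2 - r ^ 2 := by nlinarith
  have h2 : ‖z‖ ^ α / 4 ≤ (‖z‖ ^ 2 - r ^ 2) ^ (α / 2) := by
    calc ‖z‖ ^ α / 4 ≤ ‖z‖ ^ α / 2 ^ α := by
          gcongr
          calc (2 : ℝ) ^ α ≤ 2 ^ (2 : ℝ) := Real.rpow_le_rpow_of_exponent_le (by norm_num) hα2.le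
            _ = 4 := by norm_num
      _ = ((‖z‖ / 2) ^ 2) ^ (α / 2) := by
          rw [sq_rpow_half (by positivity), Real.div_rpow hz0.le (by norm_num)]
      _ ≤ _ := Real.rpow_le_rpow (by positivity) (by nlinarith) (by positivity)
  rw [avgKernel_of_lt (by linarith), rpow_add_eq_mul hz0]
  calc kernelConst n α * (r ^ α / ((‖z‖ ^ 2 - r ^ 2) ^ (α / 2) * ‖z‖ ^ n))
      ≤ kernelConst n α * (r ^ α / (‖z‖ ^ α / 4 * ‖z‖ ^ n)) := by gcongr
    _ = _ := by field_simp

theorem tendsto_avgKernel_div {n : ℕ} {α : ℝ} {z : EuclideanSpace ℝ (Fin n)} (hz : z ≠ 0) :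
    Tendsto (fun r : ℝ => avgKernel n α r z / r ^ α) (𝓝[>] 0)
      (𝓝 (kernelConst n α / ‖z‖ ^ ((n : ℝ) + α))) := by
  have hz0 : 0 < ‖z‖ := norm_pos_iff.2 hz
  have h1 : Tendsto (fun r : ℝ => ‖z‖ ^ 2 - r ^ 2) (𝓝[>] 0) (𝓝 (‖z‖ ^ 2)) := by
    have : Continuous fun r : ℝ => ‖z‖ ^ 2 - r ^ 2 := by fun_prop
    simpa using (this.tendsto 0).mono_left nhdsWithin_le_nhds
  have h2 := (h1.rpow_const (p := α / 2) (Or.inl (by positivity))).mul_const (‖z‖ ^ n)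
  rw [sq_rpow_half hz0.le, ← rpow_add_eq_mul hz0] at h2
  refine (Tendsto.div (tendsto_const_nhds (x := kernelConst n α)) h2 (by positivity)).congr' ?_
  filter_upwards [self_mem_nhdsWithin, nhdsWithin_le_nhds (Iio_mem_nhds hz0)] with r hr hrz
  have hr0 : 0 < r ^ α := Real.rpow_pos_of_pos hr _
  rw [avgKernel_of_lt hrz, Pi.div_apply]
  field_simp

theorem abs_second_difference_le {E : Type*} [NormedAddCommGroup E] [NormedSpace ℝ E] {v : E → ℝ}
    {ρ : ℝ} {K : NNReal} (hd : ∀ y ∈ ball (0 : E) ρ, DifferentiableAt ℝ v y)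
    (hK : LipschitzOnWith K (fun y => fderiv ℝ v y) (ball 0 ρ)) {z : E} (hz : ‖z‖ < ρ) :
    |2 * v 0 - v z - v (-z)| ≤ 2 * K * ‖z‖ ^ 2 := by
  have hball : ∀ y ∈ closedBall (0 : E) ‖z‖, y ∈ ball (0 : E) ρ ∧ -y ∈ ball (0 : E) ρ := by
    intro y hy
    rw [mem_closedBall_zero_iff] at hy
    simp only [mem_ball_zero_iff, norm_neg]
    exact ⟨hy.trans_lt hz, hy.trans_lt hz⟩
  have hder : ∀ y ∈ closedBall (0 : E) ‖z‖, HasFDerivWithinAt (fun y => v y + v (-y))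
      (fderiv ℝ v y - fderiv ℝ v (-y)) (closedBall 0 ‖z‖) y := by
    intro y hy
    have h1 := (hd y (hball y hy).1).hasFDerivAt
    have h2 := (hd (-y) (hball y hy).2).hasFDerivAt.comp y (hasFDerivAt_id y).neg
    have h3 := (h1.add h2).hasFDerivWithinAt (s := closedBall 0 ‖z‖)
    refine h3.congr_fderiv ?_
    ext t
    simp [sub_eq_add_neg]
  have hbound : ∀ y ∈ closedBall (0 : E) ‖z‖,
      ‖fderiv ℝ v y - fderiv ℝ v (-y)‖ ≤ 2 * K * ‖z‖ := by
    intro y hy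
    refine (hK.norm_sub_le (hball y hy).1 (hball y hy).2).trans ?_
    rw [mem_closedBall_zero_iff] at hy
    have : ‖y - -y‖ ≤ 2 * ‖z‖ := by
      rw [sub_neg_eq_add]
      exact (norm_add_le _ _).trans (by linarith)
    calc (K : ℝ) * ‖y - -y‖ ≤ K * (2 * ‖z‖) := by gcongr
      _ = _ := by ring
  have := (convex_closedBall (0 : E) ‖z‖).norm_image_sub_le_of_norm_hasFDerivWithin_le hder hbound
    (x := 0) (y := z) (by simp) (by simp)
  simp only [neg_zero, sub_zero, Real.norm_eq_abs] at this
  rw [abs_sub_comm] at this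
  calc |2 * v 0 - v z - v (-z)| = |v 0 + v 0 - (v z + v (-z))| := by ring_nf
    _ ≤ _ := this
    _ = _ := by ring

theorem measurableSet_lt_norm {n : ℕ} (r : ℝ) :
    MeasurableSet {z : EuclideanSpace ℝ (Fin n) | r < ‖z‖} :=
  measurableSet_lt measurable_const measurable_norm

theorem integral_eq_half_symm {n : ℕ} {G : EuclideanSpace ℝ (Fin n) → ℝ} (hG : Integrable G) :
    ∫ z, G z = 1 / 2 * ∫ z, (G z + G (-z)) := by
  rw [integral_add hG hG.comp_neg, integral_neg_eq_self]
  ring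

theorem integrableOn_inv_rpow_norm {n : ℕ} (hn : 1 ≤ n) {α r : ℝ} (hα0 : 0 < α) (hα2 : α < 2)
    (hr : 0 < r) :
    IntegrableOn (fun z : EuclideanSpace ℝ (Fin n) => 1 / ‖z‖ ^ ((n : ℝ) + α)) {z | r < ‖z‖} := by
  have hc := kernelConst_pos hn hα0 hα2
  have hrα : 0 < r ^ α := Real.rpow_pos_of_pos hr _
  refine Integrable.mono' (((integrable_avgKernel hn hα0 hα2 hr).1.const_mul
    ((kernelConst n α * r ^ α)⁻¹)).integrableOn)
    (by fun_prop : Measurable fun z : EuclideanSpace ℝ (Fin n) =>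
      1 / ‖z‖ ^ ((n : ℝ) + α)).aestronglyMeasurable ?_
  refine ae_restrict_of_forall_mem (measurableSet_lt_norm r) fun z hz => ?_
  rw [Real.norm_of_nonneg (by positivity), ← div_eq_inv_mul, le_div_iff₀ (by positivity)]
  refine le_trans (le_of_eq ?_) (le_avgKernel hn hα0 hα2 hr hz)
  ring

theorem InLalpha.aestronglyMeasurable {n : ℕ} {α : ℝ} {u : EuclideanSpace ℝ (Fin n) → ℝ}
    (hu : InLalpha n α u) : AEStronglyMeasurable u := by
  have h : AEStronglyMeasurable (fun y : EuclideanSpace ℝ (Fin n) =>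
      u y / (1 + ‖y‖ ^ ((n : ℝ) + α)) * (1 + ‖y‖ ^ ((n : ℝ) + α))) :=
    Integrable.aestronglyMeasurable hu |>.mul
      (by fun_prop : Measurable fun y : EuclideanSpace ℝ (Fin n) =>
        1 + ‖y‖ ^ ((n : ℝ) + α)).aestronglyMeasurable
  convert h using 2 with y
  have : 0 < 1 + ‖y‖ ^ ((n : ℝ) + α) := by positivity
  field_simp

theorem InLalpha.integrableOn_translate {n : ℕ} {α : ℝ} (hα0 : 0 < α)
    {u : EuclideanSpace ℝ (Fin n) → ℝ} (hu : InLalpha n α u) (x : EuclideanSpace ℝ (Fin n))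
    {r : ℝ} (hr : 0 < r) :
    IntegrableOn (fun z => u (x + z) / ‖z‖ ^ ((n : ℝ) + α)) {z | r < ‖z‖} := by
  have hmeas : AEStronglyMeasurable (fun z => u (x + z)) :=
    hu.aestronglyMeasurable.comp_measurePreserving (measurePreserving_add_left volume x)
  set p : ℝ := (n : ℝ) + α with hp
  have hp0 : 0 < p := by positivity
  set C : ℝ := (r ^ p)⁻¹ + (1 + ‖x‖ / r) ^ p with hC
  have hI : Integrable (fun z => C * ‖u (x + z) / (1 + ‖x + z‖ ^ p)‖) :=
    ((Integrable.comp_add_left hu x).norm).const_mul C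
  refine Integrable.mono' hI.integrableOn
    ((hmeas.restrict).mul (by fun_prop : Measurable fun z : EuclideanSpace ℝ (Fin n) =>
      (‖z‖ ^ p)⁻¹).aestronglyMeasurable) ?_
  refine ae_restrict_of_forall_mem (measurableSet_lt_norm r) fun z (hz : r < ‖z‖) => ?_
  have hz0 : 0 < ‖z‖ := hr.trans hz
  have hkey : 1 + ‖x + z‖ ^ p ≤ C * ‖z‖ ^ p := by
    have h1 : 1 ≤ (r ^ p)⁻¹ * ‖z‖ ^ p := by
      rw [← div_eq_inv_mul, one_le_div (by positivity)]
      exact Real.rpow_le_rpow hr.le hz.le hp0.le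
    have h2 : ‖x + z‖ ^ p ≤ (1 + ‖x‖ / r) ^ p * ‖z‖ ^ p := by
      rw [← Real.mul_rpow (by positivity) hz0.le]
      refine Real.rpow_le_rpow (norm_nonneg _) ((norm_add_le x z).trans ?_) hp0.le
      have : ‖x‖ ≤ ‖x‖ / r * ‖z‖ := by
        rw [div_mul_eq_mul_div, le_div_iff₀ hr]
        gcongr
      linarith
    rw [hC, add_mul]
    linarith
  have h3 : 0 < 1 + ‖x + z‖ ^ p := by positivity
  rw [norm_div, norm_div, Real.norm_of_nonneg (r := ‖z‖ ^ p) (by positivity),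
    Real.norm_of_nonneg h3.le, mul_div_assoc', div_le_div_iff₀ (by positivity) h3]
  calc ‖u (x + z)‖ * (1 + ‖x + z‖ ^ p) ≤ ‖u (x + z)‖ * (C * ‖z‖ ^ p) := by gcongr
    _ = _ := by ring

theorem integrable_second_difference {n : ℕ} (hn : 1 ≤ n) {α : ℝ} (hα0 : 0 < α) (hα2 : α < 2)
    {v : EuclideanSpace ℝ (Fin n) → ℝ} (hm : AEStronglyMeasurable v)
    (ht : ∀ r > 0, IntegrableOn (fun z => v z / ‖z‖ ^ ((n : ℝ) + α)) {z | r < ‖z‖})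
    {ρ M : ℝ} (hρ : 0 < ρ) (hM : ∀ z, ‖z‖ < ρ → |2 * v 0 - v z - v (-z)| ≤ M * ‖z‖ ^ 2) :
    Integrable (fun z => (2 * v 0 - v z - v (-z)) / ‖z‖ ^ ((n : ℝ) + α)) := by
  have : Nonempty (Fin n) := ⟨⟨0, hn⟩⟩
  have hmeas : AEStronglyMeasurable
      (fun z => (2 * v 0 - v z - v (-z)) / ‖z‖ ^ ((n : ℝ) + α)) :=
    (((aestronglyMeasurable_const.sub hm).sub
      (hm.comp_measurePreserving (Measure.measurePreserving_neg volume)))).mul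
      (by fun_prop : Measurable fun z : EuclideanSpace ℝ (Fin n) =>
        (‖z‖ ^ ((n : ℝ) + α))⁻¹).aestronglyMeasurable
  have hnear : IntegrableOn (fun z => (2 * v 0 - v z - v (-z)) / ‖z‖ ^ ((n : ℝ) + α))
      (ball 0 ρ) := by
    have hpow : IntegrableOn (fun z : EuclideanSpace ℝ (Fin n) => ‖z‖ ^ (2 - (n : ℝ) - α))
        (ball 0 ρ) := by
      rw [integrableOn_fun_norm_addHaar volume (f := fun t : ℝ => t ^ (2 - (n : ℝ) - α)),
        finrank_euclideanSpace_fin]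
      refine (integrableOn_congr_fun (fun t ht => ?_) measurableSet_Ioo).1
        ((intervalIntegral.integrableOn_Ioo_rpow_iff hρ).2 (by linarith : -1 < 1 - α))
      rw [smul_eq_mul, ← Real.rpow_natCast, ← Real.rpow_add ht.1]
      congr 1
      push_cast [Nat.cast_sub hn]
      ring
    refine Integrable.mono' (hpow.const_mul M) hmeas.restrict ?_
    refine ae_restrict_of_forall_mem measurableSet_ball fun z hz => ?_
    rw [mem_ball_zero_iff] at hz
    rcases eq_or_ne z 0 with rfl | hz0
    · have h0 : 2 * v 0 - v 0 - v (-0) = 0 := by rw [neg_zero]; ring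
      have hM0 : 0 ≤ M := by
        by_contra! h
        obtain ⟨y, hy⟩ := exists_norm_eq (EuclideanSpace ℝ (Fin n)) (by positivity : 0 ≤ ρ / 2)
        have h1 := (abs_nonneg _).trans (hM y (by rw [hy]; linarith))
        rw [hy] at h1
        nlinarith [sq_pos_of_pos hρ]
      rw [h0, zero_div, norm_zero]
      positivity
    · have hzp : 0 < ‖z‖ := norm_pos_iff.2 hz0
      rw [norm_div, Real.norm_of_nonneg (r := ‖z‖ ^ ((n : ℝ) + α)) (by positivity),
        div_le_iff₀ (by positivity), mul_assoc, ← Real.rpow_add hzp]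
      refine (hM z hz).trans_eq ?_
      rw [← Real.rpow_natCast]
      congr 2
      push_cast
      ring
  have hfar : IntegrableOn (fun z => (2 * v 0 - v z - v (-z)) / ‖z‖ ^ ((n : ℝ) + α))
      {z | ρ / 2 < ‖z‖} := by
    have h1 := ht (ρ / 2) (by positivity)
    have h2 := (integrableOn_inv_rpow_norm hn hα0 hα2 (half_pos hρ)).const_mul (2 * v 0)
    have h3 : IntegrableOn (fun z => v (-z) / ‖z‖ ^ ((n : ℝ) + α)) {z | ρ / 2 < ‖z‖} := by
      rw [← integrable_indicator_iff (measurableSet_lt_norm _)] at h1 ⊢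
      refine h1.comp_neg.congr (Eventually.of_forall fun z => ?_)
      simp [Set.indicator_apply]
    refine ((h2.sub h1).sub h3).congr (Eventually.of_forall fun z => ?_)
    simp only [Pi.sub_apply]
    ring
  have hun : ball (0 : EuclideanSpace ℝ (Fin n)) ρ ∪ {z | ρ / 2 < ‖z‖} = Set.univ := by
    ext z
    simp only [Set.mem_union, mem_ball_zero_iff, Set.mem_ofPred_eq, Set.mem_univ, iff_true]
    by_contra! h
    linarith
  rw [← integrableOn_univ, ← hun]
  exact hnear.union hfar

theorem integrable_avgKernel_mul {n : ℕ} (hn : 1 ≤ n) {α r : ℝ} (hα0 : 0 < α) (hα2 : α < 2)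
    {v : EuclideanSpace ℝ (Fin n) → ℝ} (hm : AEStronglyMeasurable v)
    (ht : ∀ r > 0, IntegrableOn (fun z => v z / ‖z‖ ^ ((n : ℝ) + α)) {z | r < ‖z‖})
    (hr : 0 < r) (hv : ContinuousOn v (closedBall 0 (2 * r))) :
    Integrable (fun z => avgKernel n α r z * v z) := by
  obtain ⟨M, hM⟩ := (isCompact_closedBall 0 (2 * r)).exists_bound_of_continuousOn hv
  have hK := (integrable_avgKernel hn hα0 hα2 hr).1
  have hc := kernelConst_pos hn hα0 hα2
  have hM0 : 0 ≤ M := (norm_nonneg _).trans (hM 0 (by simp; positivity))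
  have hT := ((integrable_indicator_iff (measurableSet_lt_norm _)).2 (ht r hr)).norm
  refine Integrable.mono' ((hK.const_mul M).add (hT.const_mul (4 * kernelConst n α * r ^ α)))
    (hK.aestronglyMeasurable.mul hm) (Eventually.of_forall fun z => ?_)
  have hk := avgKernel_nonneg hn hα0 hα2 hr z
  have hrα : 0 < r ^ α := Real.rpow_pos_of_pos hr _
  rw [norm_mul, Real.norm_of_nonneg hk, Pi.add_apply]
  rcases le_or_gt ‖z‖ (2 * r) with h | h
  · have h1 := hM z (by simpa using h)
    have h2 : avgKernel n α r z * ‖v z‖ ≤ M * avgKernel n α r z := by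
      rw [mul_comm M]
      gcongr
    exact h2.trans (le_add_of_nonneg_right (by positivity))
  · have hz0 : 0 < ‖z‖ := by linarith
    rw [Set.indicator_of_mem (by simp only [Set.mem_ofPred_eq]; linarith), norm_div,
      Real.norm_of_nonneg (r := ‖z‖ ^ ((n : ℝ) + α)) (by positivity)]
    refine le_trans ?_ (le_add_of_nonneg_left (by positivity))
    calc avgKernel n α r z * ‖v z‖
        ≤ 4 * kernelConst n α * (r ^ α / ‖z‖ ^ ((n : ℝ) + α)) * ‖v z‖ := by
          gcongr
          exact avgKernel_le hn hα0 hα2 hr h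
      _ = _ := by ring

theorem tendsto_setIntegral_lt_norm {n : ℕ} {F : EuclideanSpace ℝ (Fin n) → ℝ}
    (hF : Integrable F) (hF0 : F 0 = 0) :
    Tendsto (fun r : ℝ => ∫ z in {z | r < ‖z‖}, F z) (𝓝[>] 0) (𝓝 (∫ z, F z)) := by
  simp_rw [← integral_indicator (measurableSet_lt_norm _)]
  refine tendsto_integral_filter_of_dominated_convergence (fun z => ‖F z‖)
    (Eventually.of_forall fun r =>
      (hF.indicator (measurableSet_lt_norm r)).aestronglyMeasurable)
    (Eventually.of_forall fun r => Eventually.of_forall fun z => norm_indicator_le_norm_self _ _)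
    hF.norm (Eventually.of_forall fun z => ?_)
  rcases eq_or_ne z 0 with rfl | hz
  · refine tendsto_const_nhds.congr fun r => ?_
    rw [hF0, Set.indicator_apply, hF0, ite_self]
  · refine tendsto_const_nhds.congr' ?_
    filter_upwards [nhdsWithin_le_nhds (Iio_mem_nhds (norm_pos_iff.2 hz))] with r hr
    rw [Set.indicator_of_mem (by exact hr)]

theorem tendsto_integral_avgKernel_far {n : ℕ} (hn : 1 ≤ n) {α : ℝ} (hα0 : 0 < α) (hα2 : α < 2)
    {w : EuclideanSpace ℝ (Fin n) → ℝ} (hm : AEStronglyMeasurable w)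
    (hw : Integrable (fun z => w z / ‖z‖ ^ ((n : ℝ) + α))) (hw0 : w 0 = 0) :
    Tendsto (fun r : ℝ => ∫ z in {z | 2 * r < ‖z‖}, avgKernel n α r z / r ^ α * w z) (𝓝[>] 0)
      (𝓝 (kernelConst n α * ∫ z, w z / ‖z‖ ^ ((n : ℝ) + α))) := by
  have hc := kernelConst_pos hn hα0 hα2
  simp_rw [← integral_indicator (measurableSet_lt_norm _)]
  rw [← integral_const_mul]
  refine tendsto_integral_filter_of_dominated_convergence
    (fun z => 4 * kernelConst n α * ‖w z / ‖z‖ ^ ((n : ℝ) + α)‖) ?_ ?_ (hw.norm.const_mul _)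
    (Eventually.of_forall fun z => ?_)
  · filter_upwards [self_mem_nhdsWithin] with r hr
    exact (((integrable_avgKernel hn hα0 hα2 hr).1.div_const _).aestronglyMeasurable.mul
      hm).indicator (measurableSet_lt_norm _)
  · filter_upwards [self_mem_nhdsWithin] with r (hr : 0 < r)
    refine Eventually.of_forall fun z => ?_
    have hrα : 0 < r ^ α := Real.rpow_pos_of_pos hr _
    by_cases h : 2 * r < ‖z‖
    · have hz0 : 0 < ‖z‖ := by linarith
      have hk := avgKernel_nonneg hn hα0 hα2 hr z
      rw [Set.indicator_of_mem (by exact h), norm_mul, norm_div (w z),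
        Real.norm_of_nonneg (r := ‖z‖ ^ ((n : ℝ) + α)) (by positivity),
        Real.norm_of_nonneg (by positivity)]
      calc avgKernel n α r z / r ^ α * ‖w z‖
          ≤ 4 * kernelConst n α * (r ^ α / ‖z‖ ^ ((n : ℝ) + α)) / r ^ α * ‖w z‖ := by
            gcongr
            exact avgKernel_le hn hα0 hα2 hr h
        _ = _ := by field_simp
    · rw [Set.indicator_of_notMem (by exact h), norm_zero]
      positivity
  · rcases eq_or_ne z 0 with rfl | hz
    · simp [hw0, Set.indicator_apply]
    · have h := (tendsto_avgKernel_div (α := α) hz).mul_const (w z)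
      rw [div_mul_eq_mul_div, mul_div_assoc] at h
      refine h.congr' ?_
      filter_upwards [nhdsWithin_le_nhds (Iio_mem_nhds (half_pos (norm_pos_iff.2 hz)))]
        with r (hr : r < ‖z‖ / 2)
      rw [Set.indicator_of_mem (by simp only [Set.mem_ofPred_eq]; linarith)]

theorem tendsto_integral_avgKernel_near {n : ℕ} (hn : 1 ≤ n) {α : ℝ} (hα0 : 0 < α) (hα2 : α < 2)
    {w : EuclideanSpace ℝ (Fin n) → ℝ} {ρ M : ℝ} (hρ : 0 < ρ) (hM0 : 0 ≤ M)
    (hM : ∀ z, ‖z‖ < ρ → |w z| ≤ M * ‖z‖ ^ 2) :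
    Tendsto (fun r : ℝ => ∫ z in {z | 2 * r < ‖z‖}ᶜ, avgKernel n α r z / r ^ α * w z) (𝓝[>] 0)
      (𝓝 0) := by
  have hlim : Tendsto (fun r : ℝ => 4 * M * r ^ (2 - α)) (𝓝[>] 0) (𝓝 0) := by
    have h := (Real.continuousAt_rpow_const 0 (2 - α) (Or.inr (by linarith))).tendsto
    rw [Real.zero_rpow (by linarith)] at h
    simpa using (h.mono_left nhdsWithin_le_nhds).const_mul (4 * M)
  refine squeeze_zero_norm' ?_ hlim
  filter_upwards [self_mem_nhdsWithin, nhdsWithin_le_nhds (Iio_mem_nhds (half_pos hρ))]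
    with r (hr : 0 < r) (hrρ : r < ρ / 2)
  have hrα : 0 < r ^ α := Real.rpow_pos_of_pos hr _
  obtain ⟨hi, hv⟩ := integrable_avgKernel hn hα0 hα2 hr
  have hg : Integrable (fun z => 4 * M * r ^ (2 - α) * avgKernel n α r z) := hi.const_mul _
  calc ‖∫ z in {z | 2 * r < ‖z‖}ᶜ, avgKernel n α r z / r ^ α * w z‖
      ≤ ∫ z in {z | 2 * r < ‖z‖}ᶜ, 4 * M * r ^ (2 - α) * avgKernel n α r z := by
        refine norm_integral_le_of_norm_le hg.integrableOn
          (ae_restrict_of_forall_mem (measurableSet_lt_norm _).compl fun z hz => ?_)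
        have hz' : ‖z‖ ≤ 2 * r := not_lt.1 hz
        have hk := avgKernel_nonneg hn hα0 hα2 hr z
        have hwz : |w z| ≤ M * (2 * r) ^ 2 :=
          (hM z (by linarith)).trans (by gcongr)
        rw [norm_mul, Real.norm_of_nonneg (by positivity), Real.norm_eq_abs]
        calc avgKernel n α r z / r ^ α * |w z|
            ≤ avgKernel n α r z / r ^ α * (M * (2 * r) ^ 2) := by gcongr
          _ = _ := by
            rw [Real.rpow_sub hr, Real.rpow_two]
            ring
    _ ≤ ∫ z, 4 * M * r ^ (2 - α) * avgKernel n α r z :=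
        setIntegral_le_integral hg (Eventually.of_forall fun z => by
          have hk := avgKernel_nonneg hn hα0 hα2 hr z
          simp only [Pi.zero_apply]
          positivity)
    _ = 4 * M * r ^ (2 - α) := by rw [integral_const_mul, hv, mul_one]

theorem setIntegral_translate {n : ℕ} (r : ℝ) (x : EuclideanSpace ℝ (Fin n))
    (g : EuclideanSpace ℝ (Fin n) → ℝ) :
    ∫ y in {y | r < ‖y - x‖}, g y = ∫ z in {z | r < ‖z‖}, g (x + z) := by
  have hs : MeasurableSet {y : EuclideanSpace ℝ (Fin n) | r < ‖y - x‖} :=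
    measurableSet_lt measurable_const (by fun_prop)
  rw [← integral_indicator hs, ← integral_indicator (measurableSet_lt_norm _),
    ← integral_add_left_eq_self _ x]
  congr 1
  ext z
  simp [Set.indicator_apply]

theorem avgConv_eq {n : ℕ} {α r : ℝ} (u : EuclideanSpace ℝ (Fin n) → ℝ)
    (x : EuclideanSpace ℝ (Fin n)) :
    avgConv n α r u x = ∫ z, avgKernel n α r z * u (x + z) := by
  rw [avgConv, setIntegral_translate, setIntegral_eq_integral_of_forall_compl_eq_zero]
  · congr 1
    ext z
    rw [sub_add_cancel_left, avgKernel_neg]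
  · intro z hz
    rw [sub_add_cancel_left, avgKernel_neg, avgKernel_of_le (not_lt.1 hz), zero_mul]

/-- Pizzetti-type formula: for `u ∈ L_α`, `C^{1,1}` near `x`,
`lim_{r→0⁺} r^{-α}[u(x) - (ε_α^{(r)} * u)(x)] = c · (-Δ)^{α/2}u(x)` (the principal
value on the right-hand side existing as well), with
`c = (Γ(n/2)/π^{n/2+1}) sin(πα/2)`. -/
theorem pizzetti_formula (n : ℕ) (hn : 1 ≤ n) (α : ℝ) (hα0 : 0 < α) (hα2 : α < 2)
    (u : EuclideanSpace ℝ (Fin n) → ℝ) (hu_L : InLalpha n α u)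
    (x : EuclideanSpace ℝ (Fin n))
    (hreg : ∃ ρ > (0 : ℝ), ∃ K : NNReal,
      (∀ y ∈ ball x ρ, DifferentiableAt ℝ u y) ∧
      LipschitzOnWith K (fun y => fderiv ℝ u y) (ball x ρ)) :
    ∃ L : ℝ,
      Tendsto (fun r : ℝ =>
          ∫ y in {y : EuclideanSpace ℝ (Fin n) | r < ‖y - x‖},
            (u x - u y) / ‖x - y‖ ^ ((n : ℝ) + α))
        (𝓝[>] 0) (𝓝 L) ∧
      Tendsto (fun r : ℝ => (u x - avgConv n α r u x) / r ^ α)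
        (𝓝[>] 0)
        (𝓝 ((Real.Gamma ((n : ℝ) / 2) / Real.pi ^ ((n : ℝ) / 2 + 1)) *
          Real.sin (Real.pi * α / 2) * L)) := by
  obtain ⟨ρ, hρ, K, hd, hK⟩ := hreg
  set v : EuclideanSpace ℝ (Fin n) → ℝ := fun z => u (x + z) with hv
  have hv0 : v 0 = u x := by simp [hv]
  have hmem : ∀ z ∈ ball (0 : EuclideanSpace ℝ (Fin n)) ρ, x + z ∈ ball x ρ := by
    intro z hz
    simpa using hz
  have hvd : ∀ z ∈ ball (0 : EuclideanSpace ℝ (Fin n)) ρ, DifferentiableAt ℝ v z := fun z hz =>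
    (differentiableAt_comp_add_left x).2 (hd _ (hmem z hz))
  have hvK : LipschitzOnWith K (fun z => fderiv ℝ v z) (ball 0 ρ) := by
    refine LipschitzOnWith.of_dist_le_mul fun y hy z hz => ?_
    simp only [hv, fderiv_comp_add_left]
    simpa using hK.dist_le_mul _ (hmem y hy) _ (hmem z hz)
  have hM : ∀ z : EuclideanSpace ℝ (Fin n), ‖z‖ < ρ →
      |2 * v 0 - v z - v (-z)| ≤ 2 * K * ‖z‖ ^ 2 := fun z hz =>
    abs_second_difference_le hvd hvK hz
  have hm : AEStronglyMeasurable v :=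
    hu_L.aestronglyMeasurable.comp_measurePreserving (measurePreserving_add_left volume x)
  have ht : ∀ r > 0, IntegrableOn (fun z => v z / ‖z‖ ^ ((n : ℝ) + α)) {z | r < ‖z‖} :=
    fun r hr => hu_L.integrableOn_translate hα0 x hr
  set w : EuclideanSpace ℝ (Fin n) → ℝ := fun z => 2 * v 0 - v z - v (-z) with hw
  have hw0 : w 0 = 0 := by
    simp only [hw, neg_zero]
    ring
  have hwm : AEStronglyMeasurable w := (aestronglyMeasurable_const.sub hm).sub
    (hm.comp_measurePreserving (Measure.measurePreserving_neg volume))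
  have hF : Integrable (fun z => w z / ‖z‖ ^ ((n : ℝ) + α)) :=
    integrable_second_difference hn hα0 hα2 hm ht hρ hM
  refine ⟨1 / 2 * ∫ z, w z / ‖z‖ ^ ((n : ℝ) + α), ?_, ?_⟩
  · refine ((tendsto_setIntegral_lt_norm hF (by rw [hw0, zero_div])).const_mul (1 / 2)).congr' ?_
    filter_upwards [self_mem_nhdsWithin] with r (hr : 0 < r)
    have hI : IntegrableOn (fun z => (v 0 - v z) / ‖z‖ ^ ((n : ℝ) + α)) {z | r < ‖z‖} := by
      refine (((integrableOn_inv_rpow_norm hn hα0 hα2 hr).const_mul (v 0)).sub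
        (ht r hr)).congr (Eventually.of_forall fun z => ?_)
      simp only [Pi.sub_apply]
      ring
    rw [setIntegral_translate, ← integral_indicator (measurableSet_lt_norm _),
      ← integral_indicator (measurableSet_lt_norm _)]
    have hI' := (integrable_indicator_iff (measurableSet_lt_norm _)).2 hI
    have hsym := integral_eq_half_symm hI'
    simp only [hv0] at hsym
    simp only [sub_add_cancel_left, norm_neg]
    refine Eq.trans ?_ hsym.symm
    congr 2
    ext z
    by_cases h : r < ‖z‖
    · simp only [Set.indicator_apply, Set.mem_ofPred_eq, norm_neg, h, if_true, hw, hv0]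
      ring
    · simp [h]
  · change Tendsto _ _ (𝓝 (kernelConst n α * (1 / 2 * ∫ z, w z / ‖z‖ ^ ((n : ℝ) + α))))
    have hsum := ((tendsto_integral_avgKernel_far hn hα0 hα2 hwm hF hw0).add
      (tendsto_integral_avgKernel_near hn hα0 hα2 hρ (by positivity) hM)).const_mul (1 / 2)
    rw [add_zero, mul_left_comm] at hsum
    refine hsum.congr' ?_
    filter_upwards [self_mem_nhdsWithin, nhdsWithin_le_nhds (Iio_mem_nhds (half_pos hρ))]
      with r (hr : 0 < r) (hrρ : r < ρ / 2)
    have hcont : ContinuousOn v (closedBall 0 (2 * r)) := fun z hz =>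
      (hvd z (by
        rw [mem_closedBall_zero_iff] at hz
        rw [mem_ball_zero_iff]
        linarith)).continuousAt.continuousWithinAt
    obtain ⟨hi, hone⟩ := integrable_avgKernel hn hα0 hα2 hr
    have hkv := integrable_avgKernel_mul hn hα0 hα2 hm ht hr hcont
    have hG : Integrable (fun z => avgKernel n α r z / r ^ α * (v 0 - v z)) := by
      refine (((hi.const_mul (v 0)).sub hkv).div_const (r ^ α)).congr
        (Eventually.of_forall fun z => ?_)
      simp only [Pi.sub_apply]
      ring
    have hsymm : ∀ z, avgKernel n α r z / r ^ α * (v 0 - v z) +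
        avgKernel n α r (-z) / r ^ α * (v 0 - v (-z)) = avgKernel n α r z / r ^ α * w z := by
      intro z
      rw [avgKernel_neg]
      simp only [hw]
      ring
    have hGw : Integrable (fun z => avgKernel n α r z / r ^ α * w z) :=
      (hG.add hG.comp_neg).congr (Eventually.of_forall hsymm)
    have hdiff : (u x - avgConv n α r u x) / r ^ α =
        ∫ z, avgKernel n α r z / r ^ α * (v 0 - v z) := by
      calc (u x - avgConv n α r u x) / r ^ α
          = ((∫ z, v 0 * avgKernel n α r z) - ∫ z, avgKernel n α r z * v z) / r ^ α := by
            rw [avgConv_eq, integral_const_mul, hone, mul_one, hv0]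
        _ = ∫ z, (v 0 * avgKernel n α r z - avgKernel n α r z * v z) / r ^ α := by
            rw [← integral_sub (hi.const_mul _) hkv, integral_div]
        _ = _ := by
            congr 1
            ext z
            ring
    rw [hdiff, integral_eq_half_symm hG]
    simp only [hsymm]
    rw [integral_add_compl (measurableSet_lt_norm _) hGw]
end
end

section
/- Let n ≥ 1 and 0 < α < 2. Then for every r > 0, ∫_{{x : |x| > r}} (Γ(n/2)/π^{n/2+1}) sin(πα/2) · r^α/((|x|² - r²)^{α/2} |x|^n) dx = 1; that is, the averaging kernel ε_α^{(r)} has total integral 1 over ℝⁿ. -/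
open MeasureTheory Filter Topology Metric

noncomputable section

/-- Euler's beta integral at `(a, 1 - a)`, evaluated by the reflection formula. -/
lemma integral_rpow_mul_one_sub_rpow_neg {a : ℝ} (ha0 : 0 < a) (ha1 : a < 1) :
    ∫ u in Set.Ioo (0 : ℝ) 1, u ^ (a - 1) * (1 - u) ^ (-a) =
      Real.pi / Real.sin (Real.pi * a) := by
  have h1 : ProbabilityTheory.beta a (1 - a) = Real.pi / Real.sin (Real.pi * a) := by
    rw [ProbabilityTheory.beta, add_sub_cancel, Real.Gamma_one, div_one,
      Real.Gamma_mul_Gamma_one_sub]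
  rw [← h1, ProbabilityTheory.beta_eq_betaIntegralReal a (1 - a) ha0 (by linarith),
    Complex.betaIntegral, intervalIntegral.integral_of_le zero_le_one, integral_Ioc_eq_integral_Ioo,
    ← Complex.ofReal_re (∫ u in Set.Ioo (0 : ℝ) 1, u ^ (a - 1) * (1 - u) ^ (-a)),
    ← integral_complex_ofReal]
  congr 1
  refine setIntegral_congr_fun measurableSet_Ioo fun u hu ↦ ?_
  have hu1 : 0 ≤ 1 - u := by linarith [hu.2]
  simp only [Complex.ofReal_mul, Complex.ofReal_cpow hu.1.le, Complex.ofReal_cpow hu1]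
  push_cast
  ring_nf

lemma image_mul_rpow_neg_half_Ioo {r : ℝ} (hr : 0 < r) :
    (fun u : ℝ ↦ r * u ^ (-(1 / 2) : ℝ)) '' Set.Ioo 0 1 = Set.Ioi r := by
  ext s
  constructor
  · rintro ⟨u, hu, rfl⟩
    exact lt_mul_of_one_lt_right hr
      (Real.one_lt_rpow_of_pos_of_lt_one_of_neg hu.1 hu.2 (by norm_num))
  · intro hs
    have hs0 : 0 < s := hr.trans hs
    have h1 : 1 < s / r := (one_lt_div hr).2 hs
    refine ⟨(s / r) ^ (-2 : ℝ), ⟨by positivity, Real.rpow_lt_one_of_one_lt_of_neg h1 (by norm_num)⟩,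
      ?_⟩
    simp only
    rw [← Real.rpow_mul (by positivity)]
    norm_num
    field_simp

lemma integral_Ioi_inv_sq_sub_sq_rpow_mul {r a : ℝ} (hr : 0 < r) (ha0 : 0 < a) (ha1 : a < 1) :
    ∫ s in Set.Ioi r, ((s ^ 2 - r ^ 2) ^ a * s)⁻¹ =
      Real.pi / (2 * r ^ (2 * a) * Real.sin (Real.pi * a)) := by
  have hderiv : ∀ u ∈ Set.Ioo (0 : ℝ) 1, HasDerivWithinAt (fun u : ℝ ↦ r * u ^ (-(1 / 2) : ℝ))
      (r * (-(1 / 2) * u ^ (-(1 / 2) - 1 : ℝ))) (Set.Ioo 0 1) u := fun u hu ↦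
    ((Real.hasDerivAt_rpow_const (Or.inl hu.1.ne')).const_mul r).hasDerivWithinAt
  have hanti : AntitoneOn (fun u : ℝ ↦ r * u ^ (-(1 / 2) : ℝ)) (Set.Ioo 0 1) :=
    fun u hu v _ huv ↦ mul_le_mul_of_nonneg_left
      (Real.rpow_le_rpow_of_nonpos hu.1 huv (by norm_num)) hr.le
  rw [← image_mul_rpow_neg_half_Ioo hr,
    integral_image_eq_integral_deriv_smul_of_antitoneOn measurableSet_Ioo hderiv hanti]
  have hcongr : ∀ u ∈ Set.Ioo (0 : ℝ) 1,
      (-(r * (-(1 / 2) * u ^ (-(1 / 2) - 1 : ℝ)))) •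
        (((r * u ^ (-(1 / 2) : ℝ)) ^ 2 - r ^ 2) ^ a * (r * u ^ (-(1 / 2) : ℝ)))⁻¹ =
      (2 * r ^ (2 * a))⁻¹ * (u ^ (a - 1) * (1 - u) ^ (-a)) := by
    intro u hu
    have hu0 := hu.1
    have hu1 : 0 < 1 - u := by linarith [hu.2]
    have hsq : (u ^ (-(1 / 2) : ℝ)) ^ 2 = u⁻¹ := by
      rw [← Real.rpow_natCast, ← Real.rpow_mul hu0.le, ← Real.rpow_neg_one]
      norm_num
    have hbase : (r * u ^ (-(1 / 2) : ℝ)) ^ 2 - r ^ 2 = r ^ 2 * (1 - u) * u⁻¹ := by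
      rw [mul_pow, hsq]
      field_simp
    have hr2 : (r ^ 2) ^ a = r ^ (2 * a) := by
      rw [Real.rpow_mul hr.le, Real.rpow_two]
    rw [hbase, Real.mul_rpow (by positivity) (by positivity),
      Real.mul_rpow (by positivity) hu1.le, hr2, Real.inv_rpow hu0.le, Real.rpow_neg hu1.le,
      Real.rpow_sub_one hu0.ne', Real.rpow_sub_one hu0.ne', smul_eq_mul]
    have := (Real.rpow_pos_of_pos hu0 (-(1 / 2))).ne'
    field_simp
  rw [setIntegral_congr_fun measurableSet_Ioo hcongr, integral_const_mul,
    integral_rpow_mul_one_sub_rpow_neg ha0 ha1]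
  ring

/-- The surface area of the unit sphere in `ℝⁿ`. -/
lemma natCast_mul_volume_real_unitBall {n : ℕ} (hn : 1 ≤ n) :
    (n : ℝ) * volume.real (ball (0 : EuclideanSpace ℝ (Fin n)) 1) =
      2 * Real.pi ^ ((n : ℝ) / 2) / Real.Gamma ((n : ℝ) / 2) := by
  have : Nonempty (Fin n) := ⟨⟨0, hn⟩⟩
  have hn0 : (0 : ℝ) < n := by exact_mod_cast hn
  have hG : 0 < Real.Gamma ((n : ℝ) / 2) := Real.Gamma_pos_of_pos (by positivity)
  rw [Measure.real, EuclideanSpace.volume_ball, Fintype.card_fin, ENNReal.ofReal_one, one_pow,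
    one_mul, Real.Gamma_add_one (by positivity), ENNReal.toReal_ofReal (by positivity),
    Real.sqrt_eq_rpow, ← Real.rpow_mul_natCast Real.pi_pos.le, one_div_mul_eq_div]
  field_simp

/-- The averaging kernel `ε_α^{(r)}` has total integral `1`:
`∫_{|x|>r} (Γ(n/2)/π^{n/2+1}) sin(πα/2) · r^α/((|x|²-r²)^{α/2} |x|^n) dx = 1`. -/
theorem avgKernel_integral_eq_one (n : ℕ) (hn : 1 ≤ n) (α : ℝ)
    (hα0 : 0 < α) (hα2 : α < 2) (r : ℝ) (hr : 0 < r) :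
    ∫ x in {x : EuclideanSpace ℝ (Fin n) | r < ‖x‖},
      (Real.Gamma ((n : ℝ) / 2) / Real.pi ^ ((n : ℝ) / 2 + 1)) * Real.sin (Real.pi * α / 2) *
        (r ^ α / ((‖x‖ ^ 2 - r ^ 2) ^ (α / 2) * ‖x‖ ^ n)) = 1 := by
  have : Nonempty (Fin n) := ⟨⟨0, hn⟩⟩
  have hradial : ∫ x in {x : EuclideanSpace ℝ (Fin n) | r < ‖x‖},
      ((‖x‖ ^ 2 - r ^ 2) ^ (α / 2) * ‖x‖ ^ n)⁻¹ =
      2 * Real.pi ^ ((n : ℝ) / 2) / Real.Gamma ((n : ℝ) / 2) *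
        ∫ s in Set.Ioi r, ((s ^ 2 - r ^ 2) ^ (α / 2) * s)⁻¹ := by
    have hmeas : MeasurableSet {x : EuclideanSpace ℝ (Fin n) | r < ‖x‖} :=
      measurableSet_lt measurable_const measurable_norm
    have h := integral_fun_norm_addHaar (volume : Measure (EuclideanSpace ℝ (Fin n)))
      ((Set.Ioi r).indicator fun s ↦ ((s ^ 2 - r ^ 2) ^ (α / 2) * s ^ n)⁻¹)
    rw [finrank_euclideanSpace_fin, nsmul_eq_mul, smul_eq_mul, ← mul_assoc,
      natCast_mul_volume_real_unitBall hn] at h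
    rw [← integral_indicator hmeas]
    refine h.trans ?_
    congr 1
    have hind (s : ℝ) := (Set.indicator_smul_apply (Set.Ioi r) (fun s : ℝ ↦ s ^ (n - 1))
      (fun s : ℝ ↦ ((s ^ 2 - r ^ 2) ^ (α / 2) * s ^ n)⁻¹) s).symm
    simp only [hind]
    rw [setIntegral_indicator measurableSet_Ioi,
      Set.inter_eq_right.2 (Set.Ioi_subset_Ioi hr.le)]
    refine setIntegral_congr_fun measurableSet_Ioi fun s hs ↦ ?_
    have hs0 : 0 < s := hr.trans hs
    obtain ⟨m, rfl⟩ := Nat.exists_eq_add_of_le' hn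
    simp only [smul_eq_mul, add_tsub_cancel_right, pow_succ s m]
    field_simp
  have hsin : 0 < Real.sin (Real.pi * α / 2) :=
    Real.sin_pos_of_pos_of_lt_pi (by positivity) (by nlinarith [Real.pi_pos])
  have hG : 0 < Real.Gamma ((n : ℝ) / 2) := Real.Gamma_pos_of_pos (by positivity)
  simp_rw [div_eq_mul_inv (r ^ α)]
  rw [integral_const_mul, integral_const_mul, hradial,
    integral_Ioi_inv_sq_sub_sq_rpow_mul hr (by positivity) (by linarith),
    Real.rpow_add Real.pi_pos, Real.rpow_one, mul_div_cancel₀ α two_ne_zero, ← mul_div_assoc]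
  field_simp
end
end
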